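/- Let f(z) = z_1 z_n + g(z_2,...,z_{n−1}) where g is a polynomial in the middle variables. Then f has an isolated singularity at 0 in ℂⁿ if and only if g has an isolated singularity at 0 in ℂ^{n−2}, and the Łojasiewicz exponent satisfies L(f) = max(1, L(g)). -/

import Mathlib

open MvPolynomial Filter

/-- Euclidean norm on `ℂⁿ`. -/
noncomputable def eNorm (n : ℕ) (z : Fin n → ℂ) : ℝ :=
  Real.sqrt (∑ i, ‖z i‖ ^ 2)

/-- The Łojasiewicz exponent defined as
`inf {λ > 0 : ‖grad f‖ ≥ c ‖z‖^λ near 0}`. -/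
noncomputable def lojInf (n : ℕ) (f : MvPolynomial (Fin n) ℂ) : ℝ :=
  sInf {l : ℝ | 0 < l ∧ ∃ c > (0 : ℝ), ∀ᶠ z in nhds (0 : Fin n → ℂ),
    c * eNorm n z ^ l ≤ eNorm n (fun i => eval z (pderiv i f))}

theorem root_bound_aux (p : Polynomial ℂ) (hp : p.Monic) (x : ℂ) (hx : p.eval x = 0) :
    ‖x‖ ≤ 1 + ∑ j ∈ Finset.range p.natDegree, ‖p.coeff j‖ := by
  have hS : 0 ≤ ∑ j ∈ Finset.range p.natDegree, ‖p.coeff j‖ :=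
    Finset.sum_nonneg fun _ _ => norm_nonneg _
  by_contra! hlt
  have h1 : 1 < ‖x‖ := by linarith
  rw [Polynomial.eval_eq_sum_range, Finset.sum_range_succ, hp.coeff_natDegree, one_mul] at hx
  rcases hd : p.natDegree with _ | d
  · rw [hd] at hx; simp at hx
  · have h2 : ‖x‖ ^ (d+1) ≤ (∑ j ∈ Finset.range (d+1), ‖p.coeff j‖) * ‖x‖ ^ d := by
      rw [hd] at hx
      have : x ^ (d+1) = - ∑ j ∈ Finset.range (d+1), p.coeff j * x ^ j := by
        linear_combination hx
      rw [← norm_pow, this, norm_neg, Finset.sum_mul]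
      refine (norm_sum_le _ _).trans (Finset.sum_le_sum fun j hj => ?_)
      rw [norm_mul, norm_pow]
      have : j ≤ d := by simp at hj; omega
      gcongr
      exact h1.le
    have h3 : 0 < ‖x‖ ^ d := by positivity
    rw [pow_succ'] at h2
    rw [hd] at hlt
    have := le_of_mul_le_mul_right h2 h3
    linarith

theorem small_root_aux (p : Polynomial ℂ) (hp : p.Monic) (ε : ℝ) (hε : 0 < ε)
    (h : ‖p.coeff 0‖ < ε ^ p.natDegree) : ∃ x, p.eval x = 0 ∧ ‖x‖ < ε := by
  by_contra! hc
  have hs : p.Splits := IsAlgClosed.splits p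
  have h0 := hs.coeff_zero_eq_prod_roots_of_monic hp
  have hcard := hs.natDegree_eq_card_roots
  have : ε ^ p.natDegree ≤ ‖p.coeff 0‖ := by
    rw [h0, norm_mul, norm_pow, norm_neg, norm_one, one_pow, one_mul, hcard]
    have hr : ∀ x ∈ p.roots, ε ≤ ‖x‖ := fun x hx =>
      hc x ((Polynomial.mem_roots'.1 hx).2)
    generalize p.roots = s at hr
    induction s using Multiset.induction_on with
    | empty => simp
    | cons a s ih =>
      rw [Multiset.prod_cons, Multiset.card_cons, norm_mul, pow_succ']
      have := ih (fun x hx => hr x (Multiset.mem_cons_of_mem hx))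
      have := hr a (Multiset.mem_cons_self a s)
      gcongr
  linarith

/-- Lying over for a polynomial quotient which is integral over a polynomial ring, together with
one further function. -/
theorem point_over_aux {n s : ℕ} (P : Ideal (MvPolynomial (Fin n) ℂ)) [P.IsPrime]
    (φ : MvPolynomial (Fin s) ℂ →ₐ[ℂ] (MvPolynomial (Fin n) ℂ ⧸ P))
    (hinj : Function.Injective φ) (hintegral : φ.IsIntegral) (t : MvPolynomial (Fin n) ℂ) :
    ∃ χ : Polynomial (MvPolynomial (Fin s) ℂ), χ.Monic ∧ 0 < χ.natDegree ∧
      Polynomial.eval₂ φ.toRingHom (Ideal.Quotient.mk P t) χ = 0 ∧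
      ∀ (y : Fin s → ℂ) (τ : ℂ), (χ.map (eval y)).eval τ = 0 →
        ∃ z : Fin n → ℂ, (∀ p ∈ P, eval z p = 0) ∧ eval z t = τ ∧
          ∀ (j : Fin s) (h : MvPolynomial (Fin n) ℂ), Ideal.Quotient.mk P h = φ (X j) →
            eval z h = y j := by
  let : Algebra (MvPolynomial (Fin s) ℂ) (MvPolynomial (Fin n) ℂ ⧸ P) := φ.toRingHom.toAlgebra
  let : Module (MvPolynomial (Fin s) ℂ) (MvPolynomial (Fin n) ℂ ⧸ P) := Algebra.toModule
  have hmap : algebraMap (MvPolynomial (Fin s) ℂ) (MvPolynomial (Fin n) ℂ ⧸ P) = φ.toRingHom := rfl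
  have : Algebra.IsIntegral (MvPolynomial (Fin s) ℂ) (MvPolynomial (Fin n) ℂ ⧸ P) := ⟨hintegral⟩
  have : FaithfulSMul (MvPolynomial (Fin s) ℂ) (MvPolynomial (Fin n) ℂ ⧸ P) :=
    (faithfulSMul_iff_algebraMap_injective _ _).2 hinj
  have : Module.IsTorsionFree (MvPolynomial (Fin s) ℂ) (MvPolynomial (Fin n) ℂ ⧸ P) := by
    infer_instance
  set tb := Ideal.Quotient.mk P t with htb
  have hti : IsIntegral (MvPolynomial (Fin s) ℂ) tb := Algebra.IsIntegral.isIntegral tb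
  refine ⟨minpoly _ tb, minpoly.monic hti, minpoly.natDegree_pos hti, minpoly.aeval _ tb, ?_⟩
  intro y τ hτ
  let ψ : Polynomial (MvPolynomial (Fin s) ℂ) →+* (MvPolynomial (Fin n) ℂ ⧸ P) :=
    Polynomial.eval₂RingHom φ.toRingHom tb
  let e : Polynomial (MvPolynomial (Fin s) ℂ) →+* ℂ := Polynomial.eval₂RingHom (eval y) τ
  have hesurj : Function.Surjective e := fun c =>
    ⟨Polynomial.C (C c), by simp [e]⟩
  have hQ0 : (RingHom.ker e).IsMaximal := RingHom.ker_isMaximal_of_surjective e hesurj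
  have hker : (⊥ : Ideal (MvPolynomial (Fin n) ℂ ⧸ P)).comap ψ ≤ RingHom.ker e := by
    intro q hq
    have hq' : Polynomial.aeval tb q = 0 := hq
    obtain ⟨r, rfl⟩ := minpoly.isIntegrallyClosed_dvd hti hq'
    rw [RingHom.mem_ker, map_mul]
    have : e (minpoly _ tb) = 0 := by
      simp only [e, Polynomial.coe_eval₂RingHom]
      rw [← Polynomial.eval_map]; exact hτ
    rw [this, zero_mul]
  have hψint : ψ.IsIntegral := by
    have : ψ.comp Polynomial.C = φ.toRingHom := by ext <;> simp [ψ]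
    apply RingHom.IsIntegral.tower_top Polynomial.C ψ
    rw [this]; exact hintegral
  obtain ⟨Q, -, hQp, hQc⟩ : ∃ Q ≥ (⊥ : Ideal (MvPolynomial (Fin n) ℂ ⧸ P)), Q.IsPrime ∧
      Q.comap ψ = RingHom.ker e := by
    let := ψ.toAlgebra
    have : Algebra.IsIntegral (Polynomial (MvPolynomial (Fin s) ℂ))
      (MvPolynomial (Fin n) ℂ ⧸ P) := ⟨hψint⟩
    exact Ideal.exists_ideal_over_prime_of_isIntegral (RingHom.ker e) ⊥ hker
  have : Q.IsMaximal := Ideal.isMaximal_of_isIntegral_of_isMaximal_comap' ψ hψint Q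
    (by rw [hQc]; exact hQ0)
  have hM : (Q.comap (Ideal.Quotient.mk P)).IsMaximal :=
    Ideal.comap_isMaximal_of_surjective _ Ideal.Quotient.mk_surjective
  obtain ⟨z, hz⟩ := (MvPolynomial.isMaximal_iff_eq_vanishingIdeal_singleton).1 hM
  have hz' : ∀ p, Ideal.Quotient.mk P p ∈ Q ↔ eval z p = 0 := by
    intro p
    rw [← Ideal.mem_comap, hz, mem_vanishingIdeal_singleton_iff]
    rfl
  refine ⟨z, fun p hp => ?_, ?_, fun j h hj => ?_⟩
  · rw [← hz', Ideal.Quotient.eq_zero_iff_mem.2 hp]; exact Q.zero_mem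
  · have h1 : ψ (Polynomial.X - Polynomial.C (C τ)) ∈ Q := by
      rw [← Ideal.mem_comap, hQc, RingHom.mem_ker]; simp [e]
    have h2 : ψ (Polynomial.X - Polynomial.C (C τ)) = Ideal.Quotient.mk P (t - C τ) := by
      have : φ (C τ) = Ideal.Quotient.mk P (C τ) := φ.commutes τ
      simp [ψ, this, htb]
    rw [h2, hz'] at h1
    simpa [sub_eq_zero] using h1
  · have h1 : ψ (Polynomial.C (X j - C (y j))) ∈ Q := by
      rw [← Ideal.mem_comap, hQc, RingHom.mem_ker]; simp [e]
    have h2 : ψ (Polynomial.C (X j - C (y j))) = Ideal.Quotient.mk P (h - C (y j)) := by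
      have : φ (C (y j)) = Ideal.Quotient.mk P (C (y j)) := φ.commutes (y j)
      simp [ψ, this, hj]
    rw [h2, hz'] at h1
    simpa [sub_eq_zero] using h1

theorem mv_continuous_aux {n : ℕ} (p : MvPolynomial (Fin n) ℂ) :
    Continuous (fun z : Fin n → ℂ => eval z p) := MvPolynomial.continuous_eval p

theorem near_points_aux {n : ℕ} (P : Ideal (MvPolynomial (Fin n) ℂ)) [P.IsPrime]
    (h0 : ∀ p ∈ P, eval (0 : Fin n → ℂ) p = 0) (i : Fin n) (hi : X i ∉ P) :
    ∃ᶠ z in nhds (0 : Fin n → ℂ), z ≠ 0 ∧ ∀ p ∈ P, eval z p = 0 := by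
  obtain ⟨s, φ, hinj, hintegral⟩ :=
    exists_integral_inj_algHom_of_fg ℂ (MvPolynomial (Fin n) ℂ ⧸ P)
  -- lifts of the parameters
  choose h hh using fun j : Fin s => Ideal.Quotient.mk_surjective (I := P) (φ (X j))
  -- evaluation is compatible
  have hev : ∀ z : Fin n → ℂ, (∀ p ∈ P, eval z p = 0) → ∀ (a : MvPolynomial (Fin n) ℂ)
      (q : Polynomial (MvPolynomial (Fin s) ℂ)),
      Polynomial.eval₂ φ.toRingHom (Ideal.Quotient.mk P a) q = 0 →
      (q.map (eval (fun j => eval z (h j)))).eval (eval z a) = 0 := by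
    intro z hz a q hq
    let ev : (MvPolynomial (Fin n) ℂ ⧸ P) →+* ℂ := Ideal.Quotient.lift P (eval z) hz
    have hcomp : ev.comp φ.toRingHom = eval (fun j => eval z (h j)) := by
      apply MvPolynomial.ringHom_ext
      · intro c
        have : φ (C c) = Ideal.Quotient.mk P (C c) := φ.commutes c
        simp [ev, this]
      · intro j
        simp [ev, ← hh]
    have h1 := congrArg ev hq
    rw [Polynomial.hom_eval₂, hcomp, map_zero] at h1
    rw [Polynomial.eval_map]
    simpa [ev] using h1
  -- the number of parameters is positive
  have hs : 0 < s := by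
    rcases Nat.eq_zero_or_pos s with rfl | hs
    swap
    · exact hs
    exfalso
    obtain ⟨q, hqm, hq⟩ := hintegral (Ideal.Quotient.mk P (X i))
    have hF : IsField (MvPolynomial (Fin 0) ℂ) :=
      MulEquiv.isField (Field.toIsField ℂ) (isEmptyAlgEquiv ℂ (Fin 0)).toMulEquiv
    let : Algebra (MvPolynomial (Fin 0) ℂ) (MvPolynomial (Fin n) ℂ ⧸ P) := φ.toRingHom.toAlgebra
    have : Algebra.IsIntegral (MvPolynomial (Fin 0) ℂ) (MvPolynomial (Fin n) ℂ ⧸ P) := ⟨hintegral⟩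
    have hA : IsField (MvPolynomial (Fin n) ℂ ⧸ P) := isField_of_isIntegral_of_isField' hF
    let ev : (MvPolynomial (Fin n) ℂ ⧸ P) →+* ℂ := Ideal.Quotient.lift P (eval 0) h0
    have hne : Ideal.Quotient.mk P (X i) ≠ 0 := fun hz =>
      hi (Ideal.Quotient.eq_zero_iff_mem.1 hz)
    obtain ⟨b, hb⟩ := hA.mul_inv_cancel hne
    have h1 := congrArg ev hb
    rw [map_mul, map_one] at h1
    simp [ev] at h1
  have hsne : Nonempty (Fin s) := ⟨⟨0, hs⟩⟩
  -- integral equations of the coordinates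
  have hpi : ∀ k : Fin n, ∃ q : Polynomial (MvPolynomial (Fin s) ℂ), q.Monic ∧
      Polynomial.eval₂ φ.toRingHom (Ideal.Quotient.mk P (X k)) q = 0 := fun k =>
    hintegral (Ideal.Quotient.mk P (X k))
  choose q hqm hq using hpi
  set y0 : Fin s → ℂ := fun j => eval 0 (h j) with hy0
  -- the fibre is finite
  let E : Set (Fin n → ℂ) := {z | z ≠ 0 ∧ (∀ p ∈ P, eval z p = 0) ∧ ∀ j, eval z (h j) = y0 j}
  have hE : E.Finite := by
    refine Set.Finite.subset (Set.Finite.pi' (t := fun k => {x : ℂ | ((q k).map (eval y0)).IsRoot x})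
      (fun k => Polynomial.finite_setOfPred_isRoot ((hqm k).map _).ne_zero)) ?_
    rintro z ⟨-, hzP, hzy⟩ k
    have := hev z hzP (X k) (q k) (hq k)
    rw [show (fun j => eval z (h j)) = y0 from funext hzy, eval_X] at this
    exact this
  -- a separating function
  obtain ⟨t, ht0, htE⟩ : ∃ t : MvPolynomial (Fin n) ℂ, eval 0 t = 0 ∧ ∀ z ∈ E, eval z t ≠ 0 := by
    have hc : ∀ z : Fin n → ℂ, ∃ k, z ≠ 0 → z k ≠ 0 := by
      intro z
      by_cases hz : z = 0
      · exact ⟨i, fun h => absurd hz h⟩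
      · obtain ⟨k, hk⟩ := Function.ne_iff.1 hz
        exact ⟨k, fun _ => hk⟩
    choose κ hκ using hc
    let u : MvPolynomial (Fin n) ℂ := ∏ z ∈ hE.toFinset, (X (κ z) - C (z (κ z)))
    have hu0 : eval 0 u ≠ 0 := by
      simp only [u, map_prod]
      refine Finset.prod_ne_zero_iff.2 fun z hz => ?_
      have hz' : z ∈ E := hE.mem_toFinset.1 hz
      simpa using hκ z hz'.1
    refine ⟨u - C (eval 0 u), by simp, fun z hz => ?_⟩
    have : eval z u = 0 := by
      simp only [u, map_prod]
      exact Finset.prod_eq_zero (hE.mem_toFinset.2 hz) (by simp)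
    simpa [this] using hu0
  obtain ⟨χ, hχm, hχd, hχ0, hχ⟩ := point_over_aux P φ hinj hintegral t
  -- bound
  let S : Fin n → (Fin s → ℂ) → ℝ := fun k y =>
    1 + ∑ j ∈ Finset.range (q k).natDegree, ‖eval y ((q k).coeff j)‖
  have hScont : ∀ k, Continuous (S k) := fun k => by
    refine continuous_const.add (continuous_finsetSum _ fun j _ => ?_)
    exact (mv_continuous_aux _).norm
  have hSpos : ∀ k y, 0 ≤ S k y := fun k y =>
    add_nonneg zero_le_one (Finset.sum_nonneg fun _ _ => norm_nonneg _)
  obtain ⟨R, hR⟩ : ∃ R : ℝ, R = ∑ k, (S k y0 + 1) := ⟨_, rfl⟩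
  have happrox : ∀ ε : ℝ, 0 < ε → ∃ z : Fin n → ℂ, z ≠ 0 ∧ (∀ p ∈ P, eval z p = 0) ∧
      ‖z‖ ≤ R ∧ (∀ j, ‖eval z (h j) - y0 j‖ < ε) ∧ ‖eval z t‖ < ε := by
    intro ε hε
    have hχ00 : eval y0 (χ.coeff 0) = 0 := by
      have := hev 0 h0 t χ hχ0
      rw [ht0, ← Polynomial.coeff_zero_eq_eval_zero, Polynomial.coeff_map] at this
      exact this
    have e1 : ∀ᶠ y in nhds y0, ‖eval y (χ.coeff 0)‖ < ε ^ χ.natDegree := by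
      refine (mv_continuous_aux (χ.coeff 0)).norm.continuousAt.eventually_lt
        continuousAt_const ?_
      simp only [hχ00, norm_zero]
      positivity
    have e2 : ∀ᶠ y in nhds y0, ∀ k, S k y < S k y0 + 1 := by
      refine eventually_all.2 fun k => ?_
      exact (hScont k).continuousAt.eventually_lt continuousAt_const (by simp)
    have e3 : ∀ᶠ y in nhds y0, ∀ j, ‖y j - y0 j‖ < ε := by
      refine eventually_all.2 fun j => ?_
      have : Continuous (fun y : Fin s → ℂ => ‖y j - y0 j‖) := by fun_prop
      exact this.continuousAt.eventually_lt continuousAt_const (by simpa using hε)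
    have hnb : (nhdsWithin y0 {y0}ᶜ).NeBot := Module.punctured_nhds_neBot ℂ (Fin s → ℂ) y0
    obtain ⟨y, ⟨hy1, hy2, hy3⟩, hyne⟩ :=
      (((e1.and (e2.and e3)).filter_mono nhdsWithin_le_nhds).and
        (self_mem_nhdsWithin (a := y0) (s := {y0}ᶜ))).exists
    obtain ⟨τ, hτ, hτε⟩ := small_root_aux (χ.map (eval y)) (hχm.map _) ε hε (by
      rw [Polynomial.coeff_map, hχm.natDegree_map]; exact hy1)
    obtain ⟨z, hzP, hzt, hzy⟩ := hχ y τ hτ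
    have hzy' : ∀ j, eval z (h j) = y j := fun j => hzy j _ (hh j)
    refine ⟨z, ?_, hzP, ?_, fun j => by rw [hzy' j]; exact hy3 j, by rw [hzt]; exact hτε⟩
    · rintro rfl
      exact hyne (funext fun j => (hzy' j).symm)
    · have hRn : ∀ k, S k y0 + 1 ≤ R := fun k => by
        rw [hR]
        exact Finset.single_le_sum (f := fun k => S k y0 + 1)
          (fun k _ => add_nonneg (hSpos k y0) zero_le_one) (Finset.mem_univ k)
      refine (pi_norm_le_iff_of_nonneg ?_).2 fun k => ?_
      · exact (add_nonneg (hSpos i y0) zero_le_one).trans (hRn i)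
      · have h1 := hev z hzP (X k) (q k) (hq k)
        rw [show (fun j => eval z (h j)) = y from funext hzy', eval_X] at h1
        have h2 := root_bound_aux _ ((hqm k).map _) _ h1
        rw [(hqm k).natDegree_map] at h2
        simp only [Polynomial.coeff_map] at h2
        exact h2.trans ((hy2 k).le.trans (hRn k))
  choose z hz0 hzP hzR hzh hzt using fun N : ℕ => happrox (1 / ((N : ℝ) + 1)) (by positivity)
  have hlim : Tendsto (fun N : ℕ => 1 / ((N : ℝ) + 1)) atTop (nhds 0) :=
    tendsto_one_div_add_atTop_nhds_zero_nat
  obtain ⟨w, -, σ, hσ, hw⟩ := (isCompact_closedBall (0 : Fin n → ℂ) R).tendsto_subseq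
    (x := z) (fun N => by simpa using hzR N)
  have hlimσ := hlim.comp hσ.tendsto_atTop
  have hcw : ∀ p : MvPolynomial (Fin n) ℂ,
      Tendsto (fun N => eval (z (σ N)) p) atTop (nhds (eval w p)) := fun p =>
    ((mv_continuous_aux p).tendsto w).comp hw
  have hwP : ∀ p ∈ P, eval w p = 0 := fun p hp => by
    refine tendsto_nhds_unique (hcw p) ?_
    simp only [hzP _ p hp]
    exact tendsto_const_nhds
  have hwt : eval w t = 0 := by
    refine tendsto_nhds_unique (hcw t) ?_
    exact squeeze_zero_norm (fun N => (hzt (σ N)).le) hlimσ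
  have hwh : ∀ j, eval w (h j) = y0 j := fun j => by
    refine sub_eq_zero.1 (tendsto_nhds_unique ((hcw (h j)).sub_const (y0 j)) ?_)
    exact squeeze_zero_norm (fun N => (hzh (σ N) j).le) hlimσ
  have hw0 : w = 0 := by
    by_contra hne
    exact htE w ⟨hne, hwP, hwh⟩ hwt
  rw [hw0] at hw
  exact hw.frequently (Frequently.of_forall fun N => ⟨hz0 _, hzP _⟩)

/-- Local Nullstellensatz at an isolated zero. -/
theorem local_nss_aux {n : ℕ} (I : Ideal (MvPolynomial (Fin n) ℂ))
    (hiso : ∀ᶠ z in nhds (0 : Fin n → ℂ), (∀ p ∈ I, eval z p = 0) → z = 0) (i : Fin n) :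
    ∃ (k : ℕ) (s : MvPolynomial (Fin n) ℂ), eval 0 s ≠ 0 ∧ s * X i ^ k ∈ I := by
  by_contra! hc
  let M : Submonoid (MvPolynomial (Fin n) ℂ) :=
    { carrier := {a | ∃ (k : ℕ) (s : MvPolynomial (Fin n) ℂ), eval 0 s ≠ 0 ∧ a = s * X i ^ k}
      one_mem' := ⟨0, 1, by simp, by simp⟩
      mul_mem' := by
        rintro _ _ ⟨k, s, hs, rfl⟩ ⟨k2, s2, hs2, rfl⟩
        exact ⟨k + k2, s * s2, by rw [map_mul]; exact mul_ne_zero hs hs2, by ring⟩ }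
  obtain ⟨P, hP, hIP, hd⟩ := Ideal.exists_le_prime_disjoint I M (by
    rw [Set.disjoint_left]
    rintro a ha ⟨k, s, hs, rfl⟩
    exact hc k s hs ha)
  rw [Set.disjoint_left] at hd
  have h1 := near_points_aux P (fun p hp => by
    by_contra hne
    exact hd hp ⟨0, p, hne, by simp⟩) i (fun hX => hd hX ⟨1, 1, by simp, by simp⟩)
  obtain ⟨z, ⟨hz0, hz⟩, hz'⟩ := (h1.and_eventually hiso).exists
  exact hz0 (hz' fun p hp => hz p (hIP hp))

theorem sum_rpow_aux {ι : Type*} [Fintype ι] [Nonempty ι] (a : ι → ℝ) (ha : ∀ i, 0 ≤ a i)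
    (l : ℝ) (hl : 0 ≤ l) : (∑ i, a i) ^ l ≤ (Fintype.card ι : ℝ) ^ l * ∑ i, a i ^ l := by
  obtain ⟨k, hk⟩ := Finite.exists_max a
  have h1 : ∑ i, a i ≤ (Fintype.card ι : ℝ) * a k := by
    have := Finset.sum_le_card_nsmul Finset.univ a (a k) (fun i _ => hk i)
    simpa using this
  calc (∑ i, a i) ^ l ≤ ((Fintype.card ι : ℝ) * a k) ^ l :=
        Real.rpow_le_rpow (Finset.sum_nonneg fun i _ => ha i) h1 hl
    _ = (Fintype.card ι : ℝ) ^ l * a k ^ l := Real.mul_rpow (Nat.cast_nonneg _) (ha k)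
    _ ≤ _ := by
        gcongr
        exact Finset.single_le_sum (f := fun i => a i ^ l)
          (fun i _ => Real.rpow_nonneg (ha i) l) (Finset.mem_univ k)

theorem eNorm_nonneg_aux {n : ℕ} (z : Fin n → ℂ) : 0 ≤ eNorm n z := Real.sqrt_nonneg _

theorem eNorm_sq_aux {n : ℕ} (z : Fin n → ℂ) : eNorm n z ^ 2 = ∑ i, ‖z i‖ ^ 2 :=
  Real.sq_sqrt (Finset.sum_nonneg fun _ _ => by positivity)

theorem le_eNorm_aux {n : ℕ} (z : Fin n → ℂ) (i : Fin n) : ‖z i‖ ≤ eNorm n z := by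
  apply Real.le_sqrt_of_sq_le
  exact Finset.single_le_sum (f := fun i => ‖z i‖ ^ 2) (fun _ _ => by positivity)
    (Finset.mem_univ i)

theorem eNorm_le_sum_aux {n : ℕ} (z : Fin n → ℂ) : eNorm n z ≤ ∑ i, ‖z i‖ := by
  have h0 : 0 ≤ ∑ i, ‖z i‖ := Finset.sum_nonneg fun _ _ => norm_nonneg _
  refine Real.sqrt_le_iff.2 ⟨h0, ?_⟩
  exact Finset.sum_sq_le_sq_sum_of_nonneg fun i _ => norm_nonneg _

theorem eNorm_cont_aux (n : ℕ) : Continuous (eNorm n) := by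
  unfold eNorm; fun_prop

theorem eNorm_zero_aux (n : ℕ) : eNorm n 0 = 0 := by simp [eNorm]

/-- Lojasiewicz inequality at an isolated zero of a polynomial map. -/
theorem loj_ineq_aux {m : ℕ} (G : Fin (m + 1) → MvPolynomial (Fin (m + 1)) ℂ)
    (hiso : ∀ᶠ z in nhds (0 : Fin (m + 1) → ℂ), (∀ i, eval z (G i) = 0) → z = 0) :
    ∃ l : ℝ, 0 < l ∧ ∃ c > (0 : ℝ), ∀ᶠ z in nhds (0 : Fin (m + 1) → ℂ),
      c * eNorm (m + 1) z ^ l ≤ eNorm (m + 1) (fun i => eval z (G i)) := by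
  have hiso' : ∀ᶠ z in nhds (0 : Fin (m + 1) → ℂ),
      (∀ p ∈ Ideal.span (Set.range G), eval z p = 0) → z = 0 := by
    filter_upwards [hiso] with z hz h
    exact hz fun i => h _ (Ideal.subset_span ⟨i, rfl⟩)
  choose k s hs hmem using local_nss_aux _ hiso'
  simp only [Ideal.mem_span_range_iff_exists_fun] at hmem
  choose a ha using hmem
  -- coordinate-wise estimates
  have hcoord : ∀ i, ∃ Cc : ℝ, 0 ≤ Cc ∧ ∀ᶠ z in nhds (0 : Fin (m + 1) → ℂ),
      ‖z i‖ ^ (k i) ≤ Cc * eNorm (m + 1) (fun i => eval z (G i)) := by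
    intro i
    have hs0 : 0 < ‖eval 0 (s i)‖ := norm_pos_iff.2 (hs i)
    refine ⟨(∑ j, (‖eval 0 (a i j)‖ + 1)) / (‖eval 0 (s i)‖ / 2),
      div_nonneg (Finset.sum_nonneg fun j _ => add_nonneg (norm_nonneg _) zero_le_one)
        (half_pos hs0).le, ?_⟩
    have e1 : ∀ᶠ z in nhds (0 : Fin (m + 1) → ℂ), ‖eval 0 (s i)‖ / 2 < ‖eval z (s i)‖ :=
      continuousAt_const.eventually_lt (mv_continuous_aux (s i)).norm.continuousAt (by linarith)
    have e2 : ∀ᶠ z in nhds (0 : Fin (m + 1) → ℂ), ∀ j,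
        ‖eval z (a i j)‖ < ‖eval 0 (a i j)‖ + 1 :=
      eventually_all.2 fun j => (mv_continuous_aux (a i j)).norm.continuousAt.eventually_lt
        continuousAt_const (by linarith)
    filter_upwards [e1, e2] with z h1 h2
    have h3 := congrArg (eval z) (ha i)
    simp only [map_sum, map_mul, map_pow, eval_X] at h3
    have h4 : ‖eval z (s i)‖ * ‖z i‖ ^ k i ≤
        (∑ j, (‖eval 0 (a i j)‖ + 1)) * eNorm (m + 1) (fun i => eval z (G i)) := by
      rw [← norm_pow, ← norm_mul, ← h3, Finset.sum_mul]
      refine (norm_sum_le _ _).trans (Finset.sum_le_sum fun j _ => ?_)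
      rw [norm_mul]
      exact mul_le_mul (h2 j).le (le_eNorm_aux (fun i => eval z (G i)) j) (norm_nonneg _)
        (add_nonneg (norm_nonneg _) zero_le_one)
    rw [div_mul_eq_mul_div, le_div_iff₀ (half_pos hs0), mul_comm]
    exact le_trans (mul_le_mul_of_nonneg_right h1.le (pow_nonneg (norm_nonneg _) _)) h4
  choose Cc hC0 hC using hcoord
  let N : ℕ := 1 + ∑ i, k i
  have hkN : ∀ i, k i ≤ N := fun i =>
    (Finset.single_le_sum (f := k) (fun _ _ => Nat.zero_le _) (Finset.mem_univ i)).trans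
      (Nat.le_add_left _ _)
  have hNpos : (0 : ℝ) < (N : ℝ) := by
    have : 0 < N := by simp only [N]; omega
    exact_mod_cast this
  obtain ⟨D, hD⟩ : ∃ D : ℝ, D = (Fintype.card (Fin (m + 1)) : ℝ) ^ (N : ℝ) * ∑ i, Cc i :=
    ⟨_, rfl⟩
  have hD0 : 0 ≤ D := by
    rw [hD]
    exact mul_nonneg (by positivity) (Finset.sum_nonneg fun i _ => hC0 i)
  refine ⟨N, hNpos, 1 / (D + 1), by positivity, ?_⟩
  have e1 : ∀ᶠ z in nhds (0 : Fin (m + 1) → ℂ), ∀ i, ‖z i‖ < 1 :=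
    eventually_all.2 fun i => ((continuous_apply i).norm).continuousAt.eventually_lt
        continuousAt_const (by simp)
  filter_upwards [e1, eventually_all.2 hC] with z h1 h2
  have hG := eNorm_nonneg_aux (fun i => eval z (G i))
  rw [div_mul_eq_mul_div, one_mul, div_le_iff₀ (by positivity)]
  calc eNorm (m + 1) z ^ (N : ℝ) ≤ (∑ i, ‖z i‖) ^ (N : ℝ) :=
        Real.rpow_le_rpow (eNorm_nonneg_aux z) (eNorm_le_sum_aux z) hNpos.le
    _ ≤ (Fintype.card (Fin (m + 1)) : ℝ) ^ (N : ℝ) * ∑ i, ‖z i‖ ^ (N : ℝ) :=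
        sum_rpow_aux _ (fun _ => norm_nonneg _) _ hNpos.le
    _ ≤ (Fintype.card (Fin (m + 1)) : ℝ) ^ (N : ℝ) *
          ∑ i, Cc i * eNorm (m + 1) (fun i => eval z (G i)) := by
        gcongr with i _
        rw [Real.rpow_natCast]
        exact (pow_le_pow_of_le_one (norm_nonneg _) (h1 i).le (hkN i)).trans (h2 i)
    _ = D * eNorm (m + 1) (fun i => eval z (G i)) := by rw [hD, ← Finset.sum_mul, mul_assoc]
    _ ≤ _ := by rw [mul_comm]; gcongr; linarith

/-- Exponents are at least one. -/
theorem one_le_loj_aux {m : ℕ} (G : Fin (m + 1) → MvPolynomial (Fin (m + 1)) ℂ)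
    (hG0 : ∀ i, eval 0 (G i) = 0) (l c : ℝ) (hc : 0 < c)
    (h : ∀ᶠ z in nhds (0 : Fin (m + 1) → ℂ),
      c * eNorm (m + 1) z ^ l ≤ eNorm (m + 1) (fun i => eval z (G i))) : 1 ≤ l := by
  by_contra! hl
  have hb : ∀ i, ∃ Cc : ℝ, ∀ᶠ z in nhds (0 : Fin (m + 1) → ℂ),
      ‖eval z (G i)‖ ≤ Cc * ‖z‖ := by
    intro i
    have hd : DifferentiableAt ℂ (fun z : Fin (m + 1) → ℂ => aeval z (G i)) 0 :=
      (AnalyticAt.aeval_mvPolynomial (f := fun z : Fin (m + 1) → ℂ => z)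
        (fun j => (ContinuousLinearMap.proj (R := ℂ) (φ := fun _ : Fin (m + 1) => ℂ) j).analyticAt 0)
        (G i)).differentiableAt
    obtain ⟨Cc, hCc⟩ := hd.isBigO_sub.bound
    refine ⟨Cc, ?_⟩
    filter_upwards [hCc] with z hz
    have h0 : aeval (0 : Fin (m + 1) → ℂ) (G i) = 0 := hG0 i
    rw [h0, sub_zero, sub_zero] at hz
    exact hz
  choose Cc hC using hb
  have hnorm : ∀ z : Fin (m + 1) → ℂ, ‖z‖ ≤ eNorm (m + 1) z := fun z =>
    (pi_norm_le_iff_of_nonneg (eNorm_nonneg_aux z)).2 (le_eNorm_aux z)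
  have hall : ∀ᶠ z in nhds (0 : Fin (m + 1) → ℂ),
      eNorm (m + 1) (fun i => eval z (G i)) ≤ (∑ i, |Cc i|) * eNorm (m + 1) z := by
    filter_upwards [eventually_all.2 hC] with z hz
    refine (eNorm_le_sum_aux _).trans ?_
    rw [Finset.sum_mul]
    refine Finset.sum_le_sum fun i _ => (hz i).trans ?_
    exact mul_le_mul (le_abs_self _) (hnorm z) (norm_nonneg _) (abs_nonneg _)
  have hnb : (nhdsWithin (0 : Fin (m + 1) → ℂ) {0}ᶜ).NeBot :=
    Module.punctured_nhds_neBot ℂ (Fin (m + 1) → ℂ) 0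
  have hlim : Tendsto (fun z : Fin (m + 1) → ℂ => (∑ i, |Cc i|) * eNorm (m + 1) z ^ (1 - l))
      (nhdsWithin 0 {0}ᶜ) (nhds 0) := by
    have hcont : ContinuousAt
        (fun z : Fin (m + 1) → ℂ => (∑ i, |Cc i|) * eNorm (m + 1) z ^ (1 - l)) 0 :=
      continuousAt_const.mul ((eNorm_cont_aux (m + 1)).continuousAt.rpow_const
        (Or.inr (by linarith)))
    have := hcont.tendsto.mono_left (nhdsWithin_le_nhds (s := {0}ᶜ))
    simpa [eNorm_zero_aux, Real.zero_rpow (show 1 - l ≠ 0 by linarith)] using this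
  have hcle : c ≤ 0 := by
    refine ge_of_tendsto hlim ?_
    filter_upwards [(h.and hall).filter_mono nhdsWithin_le_nhds, self_mem_nhdsWithin]
      with z hz hz0
    have hpos : 0 < eNorm (m + 1) z := (norm_pos_iff.2 hz0).trans_le (hnorm z)
    have h1 := hz.1.trans hz.2
    rw [Real.rpow_sub hpos, Real.rpow_one, ← mul_div_assoc,
      le_div_iff₀ (Real.rpow_pos_of_pos hpos l)]
    exact h1
  linarith

theorem eNorm_split_aux {m : ℕ} (z : Fin (m + 3) → ℂ) :
    eNorm (m + 3) z ^ 2 = ‖z 0‖ ^ 2 + eNorm (m + 1) (fun i => z i.succ.castSucc) ^ 2 +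
      ‖z (Fin.last (m + 2))‖ ^ 2 := by
  rw [eNorm_sq_aux, eNorm_sq_aux, Fin.sum_univ_castSucc, Fin.sum_univ_succ]
  simp

theorem emb_inj_aux (m : ℕ) :
    Function.Injective (fun i : Fin (m + 1) => (i.succ.castSucc : Fin (m + 3))) := fun i j h => by
  simpa using h

theorem grad_mid_aux {m : ℕ} (g : MvPolynomial (Fin (m + 1)) ℂ) (z : Fin (m + 3) → ℂ)
    (i : Fin (m + 1)) :
    eval z (pderiv (i.succ.castSucc) ((X 0 * X (Fin.last (m + 2)) +
        rename (fun i : Fin (m + 1) => i.succ.castSucc) g : MvPolynomial (Fin (m + 3)) ℂ))) =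
      eval (fun i => z i.succ.castSucc) (pderiv i g) := by
  have h1 : (0 : Fin (m + 3)) ≠ i.succ.castSucc := by
    intro h; have := congrArg Fin.val h; simp at this
  have h2 : (Fin.last (m + 2)) ≠ i.succ.castSucc := (Fin.castSucc_ne_last _).symm
  rw [map_add, pderiv_mul, pderiv_X_of_ne h1, pderiv_X_of_ne h2,
    pderiv_rename (emb_inj_aux m)]
  simp [eval_rename, Function.comp_def]

theorem pderiv_rename_out_aux {m : ℕ} (g : MvPolynomial (Fin (m + 1)) ℂ) (k : Fin (m + 3))
    (hk : ∀ i : Fin (m + 1), i.succ.castSucc ≠ k) :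
    pderiv k (rename (fun i : Fin (m + 1) => (i.succ.castSucc : Fin (m + 3))) g) = 0 := by
  classical
  apply pderiv_eq_zero_of_notMem_vars
  intro h
  have := vars_rename (fun i : Fin (m + 1) => (i.succ.castSucc : Fin (m + 3))) g h
  obtain ⟨i, -, hi⟩ := Finset.mem_image.1 this
  exact hk i hi

theorem grad_zero_aux {m : ℕ} (g : MvPolynomial (Fin (m + 1)) ℂ) (z : Fin (m + 3) → ℂ) :
    eval z (pderiv 0 ((X 0 * X (Fin.last (m + 2)) +
        rename (fun i : Fin (m + 1) => i.succ.castSucc) g : MvPolynomial (Fin (m + 3)) ℂ))) =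
      z (Fin.last (m + 2)) := by
  have h2 : (Fin.last (m + 2)) ≠ 0 := Fin.last_pos.ne'
  rw [map_add, pderiv_mul, pderiv_X_self, pderiv_X_of_ne h2, pderiv_rename_out_aux]
  · simp
  · intro i h; have := congrArg Fin.val h; simp at this

theorem grad_last_aux {m : ℕ} (g : MvPolynomial (Fin (m + 1)) ℂ) (z : Fin (m + 3) → ℂ) :
    eval z (pderiv (Fin.last (m + 2)) ((X 0 * X (Fin.last (m + 2)) +
        rename (fun i : Fin (m + 1) => i.succ.castSucc) g : MvPolynomial (Fin (m + 3)) ℂ))) =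
      z 0 := by
  have h2 : 0 ≠ (Fin.last (m + 2)) := Fin.last_pos.ne
  rw [map_add, pderiv_mul, pderiv_X_self, pderiv_X_of_ne h2, pderiv_rename_out_aux]
  · simp
  · intro i; exact Fin.castSucc_ne_last _

/-- Extension by zero in the outer variables. -/
def extAux {m : ℕ} (y : Fin (m + 1) → ℂ) : Fin (m + 3) → ℂ :=
  Fin.snoc (α := fun _ => ℂ) (Fin.cons (α := fun _ => ℂ) 0 y) 0

theorem ext_zero_aux {m : ℕ} (y : Fin (m + 1) → ℂ) : extAux y 0 = 0 := by
  have : (0 : Fin (m + 3)) = Fin.castSucc 0 := rfl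
  rw [extAux, this, Fin.snoc_castSucc, Fin.cons_zero]

theorem ext_last_aux {m : ℕ} (y : Fin (m + 1) → ℂ) : extAux y (Fin.last (m + 2)) = 0 := by
  rw [extAux, Fin.snoc_last]

theorem ext_mid_aux {m : ℕ} (y : Fin (m + 1) → ℂ) (i : Fin (m + 1)) :
    extAux y i.succ.castSucc = y i := by
  rw [extAux, Fin.snoc_castSucc, Fin.cons_succ]

theorem fin_cases_aux {m : ℕ} {Q : Fin (m + 3) → Prop} (h0 : Q 0) (hl : Q (Fin.last (m + 2)))
    (hm : ∀ i : Fin (m + 1), Q i.succ.castSucc) (i : Fin (m + 3)) : Q i := by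
  refine Fin.lastCases hl (fun j => ?_) i
  exact Fin.cases h0 hm j

theorem ext_tendsto_aux (m : ℕ) :
    Tendsto (extAux (m := m)) (nhds 0) (nhds 0) := by
  have hc : Continuous (extAux (m := m)) := by
    refine continuous_pi fun i => ?_
    refine fin_cases_aux (Q := fun i => Continuous fun y : Fin (m + 1) → ℂ => extAux y i)
      ?_ ?_ ?_ i
    · simp only [ext_zero_aux]; exact continuous_const
    · simp only [ext_last_aux]; exact continuous_const
    · intro j; simp only [ext_mid_aux]; exact continuous_apply j
  have h0 : extAux (m := m) 0 = 0 := by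
    funext i
    refine fin_cases_aux (Q := fun i => extAux (m := m) 0 i = (0 : Fin (m + 3) → ℂ) i) ?_ ?_ ?_ i
    · exact ext_zero_aux _
    · exact ext_last_aux _
    · intro j; exact ext_mid_aux _ _
  have := hc.tendsto 0
  rwa [h0] at this

theorem proj_tendsto_aux (m : ℕ) :
    Tendsto (fun (z : Fin (m + 3) → ℂ) (i : Fin (m + 1)) => z i.succ.castSucc)
      (nhds 0) (nhds 0) := by
  have hc : Continuous (fun (z : Fin (m + 3) → ℂ) (i : Fin (m + 1)) => z i.succ.castSucc) := by
    fun_prop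
  exact hc.tendsto 0

theorem loj_exponent_hyperbolic_elimination (m : ℕ)
    (g : MvPolynomial (Fin (m + 1)) ℂ)
    (hg0 : coeff 0 g = 0)
    (hgrad0 : ∀ i, eval (0 : Fin (m + 1) → ℂ) (pderiv i g) = 0) :
    letI f : MvPolynomial (Fin (m + 3)) ℂ :=
      X 0 * X (Fin.last (m + 2)) +
        rename (fun i : Fin (m + 1) => i.succ.castSucc) g
    ((∀ᶠ z in nhds (0 : Fin (m + 3) → ℂ),
        (∀ i, eval z (pderiv i f) = 0) → z = 0) ↔
      (∀ᶠ y in nhds (0 : Fin (m + 1) → ℂ),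
        (∀ i, eval y (pderiv i g) = 0) → y = 0)) ∧
    ((∀ᶠ y in nhds (0 : Fin (m + 1) → ℂ),
        (∀ i, eval y (pderiv i g) = 0) → y = 0) →
      lojInf (m + 3) f = max 1 (lojInf (m + 1) g)) := by
  have hf0 := grad_zero_aux g
  have hfl := grad_last_aux g
  have hfm := grad_mid_aux g
  generalize (X 0 * X (Fin.last (m + 2)) +
    rename (fun i : Fin (m + 1) => i.succ.castSucc) g : MvPolynomial (Fin (m + 3)) ℂ) = f
    at hf0 hfl hfm ⊢
  refine ⟨⟨fun h => ?_, fun h => ?_⟩, fun h => ?_⟩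
  · filter_upwards [(ext_tendsto_aux m).eventually h] with y hy hgy
    have h1 : extAux y = 0 := by
      refine hy fun i => ?_
      refine fin_cases_aux (Q := fun i => eval (extAux y) (pderiv i f) = 0) ?_ ?_ ?_ i
      · rw [hf0, ext_last_aux]
      · rw [hfl, ext_zero_aux]
      · intro j; rw [hfm]; simp only [ext_mid_aux]; exact hgy j
    funext i
    rw [← ext_mid_aux y i, h1]; rfl
  · filter_upwards [(proj_tendsto_aux m).eventually h] with z hz hfz
    have h1 := hz fun i => by rw [← hfm]; exact hfz _
    funext i
    refine fin_cases_aux (Q := fun i => z i = (0 : Fin (m + 3) → ℂ) i) ?_ ?_ ?_ i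
    · rw [← hfl z]; exact hfz _
    · rw [← hf0 z]; exact hfz _
    · intro j; exact congrFun h1 j
  · have hgradsq : ∀ z, eNorm (m + 3) (fun i => eval z (pderiv i f)) ^ 2 =
        ‖z (Fin.last (m + 2))‖ ^ 2 +
          eNorm (m + 1) (fun i => eval (fun i => z i.succ.castSucc) (pderiv i g)) ^ 2 +
          ‖z 0‖ ^ 2 := by
      intro z
      rw [eNorm_split_aux]
      simp only [hf0, hfl, hfm]
    have hset : {l : ℝ | 0 < l ∧ ∃ c > (0 : ℝ), ∀ᶠ z in nhds (0 : Fin (m + 3) → ℂ),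
          c * eNorm (m + 3) z ^ l ≤ eNorm (m + 3) (fun i => eval z (pderiv i f))} =
        {l : ℝ | 0 < l ∧ ∃ c > (0 : ℝ), ∀ᶠ z in nhds (0 : Fin (m + 1) → ℂ),
          c * eNorm (m + 1) z ^ l ≤ eNorm (m + 1) (fun i => eval z (pderiv i g))} := by
      ext l
      constructor
      · rintro ⟨hl, c, hc, hcz⟩
        refine ⟨hl, c, hc, ?_⟩
        filter_upwards [(ext_tendsto_aux m).eventually hcz] with y hy
        have h1 : eNorm (m + 3) (extAux y) = eNorm (m + 1) y := by
          rw [← sq_eq_sq₀ (eNorm_nonneg_aux _) (eNorm_nonneg_aux _), eNorm_split_aux,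
            ext_zero_aux, ext_last_aux]
          simp only [ext_mid_aux]
          simp
        have h2 : eNorm (m + 3) (fun i => eval (extAux y) (pderiv i f)) =
            eNorm (m + 1) (fun i => eval y (pderiv i g)) := by
          rw [← sq_eq_sq₀ (eNorm_nonneg_aux _) (eNorm_nonneg_aux _), hgradsq,
            ext_zero_aux, ext_last_aux]
          simp only [ext_mid_aux]
          simp
        rwa [h1, h2] at hy
      · rintro ⟨hl, c, hc, hcy⟩
        have hl1 : 1 ≤ l := one_le_loj_aux (fun i => pderiv i g) hgrad0 l c hc hcy
        refine ⟨hl, 1 / ((3 : ℝ) ^ l * (2 + 1 / c)), by positivity, ?_⟩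
        have e1 : ∀ᶠ z in nhds (0 : Fin (m + 3) → ℂ), ∀ i, ‖z i‖ < 1 :=
          eventually_all.2 fun i => ((continuous_apply i).norm).continuousAt.eventually_lt
            continuousAt_const (by simp)
        filter_upwards [e1, (proj_tendsto_aux m).eventually hcy] with z hz1 hz2
        set y : Fin (m + 1) → ℂ := fun i => z i.succ.castSucc with hy
        set F := eNorm (m + 3) (fun i => eval z (pderiv i f)) with hF
        set Gy := eNorm (m + 1) (fun i => eval y (pderiv i g)) with hGy
        have hF0 : 0 ≤ F := eNorm_nonneg_aux _
        have hG0 : 0 ≤ Gy := eNorm_nonneg_aux _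
        have hy0 : 0 ≤ eNorm (m + 1) y := eNorm_nonneg_aux _
        have hFsq := hgradsq z
        have ha : ‖z 0‖ ≤ F := by
          have := le_eNorm_aux (fun i => eval z (pderiv i f)) (Fin.last (m + 2))
          simp only [hfl] at this; exact this
        have hb : ‖z (Fin.last (m + 2))‖ ≤ F := by
          have := le_eNorm_aux (fun i => eval z (pderiv i f)) 0
          simp only [hf0] at this; exact this
        have hd : Gy ≤ F := by
          refine abs_le_of_sq_le_sq' ?_ hF0 |>.2
          rw [hFsq]
          nlinarith [sq_nonneg ‖z 0‖, sq_nonneg ‖z (Fin.last (m + 2))‖]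
        have hsum : eNorm (m + 3) z ≤ ‖z 0‖ + ‖z (Fin.last (m + 2))‖ + eNorm (m + 1) y := by
          refine abs_le_of_sq_le_sq' ?_ (by positivity) |>.2
          rw [eNorm_split_aux]
          have p1 := norm_nonneg (z 0)
          have p2 := norm_nonneg (z (Fin.last (m + 2)))
          nlinarith [mul_nonneg p1 p2, mul_nonneg p1 hy0, mul_nonneg p2 hy0]
        have h3 := sum_rpow_aux ![‖z 0‖, ‖z (Fin.last (m + 2))‖, eNorm (m + 1) y]
          (by intro i; fin_cases i <;> simp [hy0]) l hl.le
        simp only [Fin.sum_univ_three, Fintype.card_fin, Matrix.cons_val_zero,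
          Matrix.cons_val_one, Matrix.cons_val] at h3
        have hpow : ∀ i, ‖z i‖ ^ l ≤ ‖z i‖ := fun i => by
          have := Real.rpow_le_rpow_of_exponent_ge' (norm_nonneg (z i)) (hz1 i).le zero_le_one hl1
          rwa [Real.rpow_one] at this
        have hyl : eNorm (m + 1) y ^ l ≤ 1 / c * F := by
          rw [div_mul_eq_mul_div, one_mul, le_div_iff₀ hc, mul_comm]
          exact hz2.trans hd
        rw [div_mul_eq_mul_div, one_mul, div_le_iff₀ (by positivity)]
        calc eNorm (m + 3) z ^ l
            ≤ (‖z 0‖ + ‖z (Fin.last (m + 2))‖ + eNorm (m + 1) y) ^ l :=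
              Real.rpow_le_rpow (eNorm_nonneg_aux z) hsum hl.le
          _ ≤ (3 : ℝ) ^ l * (‖z 0‖ ^ l + ‖z (Fin.last (m + 2))‖ ^ l + eNorm (m + 1) y ^ l) := by
              exact_mod_cast h3
          _ ≤ (3 : ℝ) ^ l * (F + F + 1 / c * F) := by
              gcongr
              · exact (hpow _).trans ha
              · exact (hpow _).trans hb
          _ = F * ((3 : ℝ) ^ l * (2 + 1 / c)) := by ring
    have hEq : lojInf (m + 3) f = lojInf (m + 1) g := by
      unfold lojInf; rw [hset]
    rw [hEq, max_eq_right]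
    obtain ⟨l, hl, hl'⟩ := loj_ineq_aux (fun i => pderiv i g) h
    refine le_csInf ⟨l, hl, hl'⟩ ?_
    rintro l ⟨-, c, hc, hcy⟩
    exact one_le_loj_aux (fun i => pderiv i g) hgrad0 l c hc hcy
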